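/- arXiv:math/0202176 — 2 statements merged into one kernel-verified Lean document; each statement's English description precedes it below -/
import Mathlib

section
/- Let {T_a}_{a ∈ ι} be a basis of M_n(ℂ) with Gram matrix κ_{ab} = tr(T_a · T_b) with respect to the trace form, and let κ^{ab} denote the entries of the inverse matrix of κ. Then the element ∑_{a,b} κ^{ab} T_a ⊗ T_b of M_n(ℂ) ⊗ M_n(ℂ), acting on ℂ^n ⊗ ℂ^n in the standard representation, acts as the swap operator: for all v, w ∈ ℂ^n, (∑_{a,b} κ^{ab} T_a ⊗ T_b)(v ⊗ w) = w ⊗ v. -/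
open Matrix TensorProduct

theorem casimir_aux_det (n : ℕ) (ι : Type*) [Fintype ι] [DecidableEq ι]
    (T : Module.Basis ι ℂ (Matrix (Fin n) (Fin n) ℂ))
    (κ : Matrix ι ι ℂ) (hκ : ∀ a b : ι, κ a b = Matrix.trace (T a * T b)) :
    IsUnit κ.det := by
  rw [isUnit_iff_ne_zero]
  intro h0
  obtain ⟨c, hc, hz⟩ := Matrix.exists_mulVec_eq_zero_iff.mpr h0
  apply hc
  have hX : ∑ b, c b • T b = 0 := by
    rw [Matrix.ext_iff_trace_mul_left]
    intro Y
    have h1 : ∀ a, Matrix.trace (T a * ∑ b, c b • T b) = 0 := by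
      intro a
      have := congrFun hz a
      simp only [Matrix.mulVec, dotProduct, hκ, Pi.zero_apply] at this
      rw [← this]
      simp [Finset.mul_sum, Matrix.trace_sum, mul_comm]
    conv_lhs => rw [← T.sum_repr Y]
    rw [Finset.sum_mul, Matrix.trace_sum]
    simp only [Matrix.smul_mul, Matrix.trace_smul, h1]
    simp
  funext b
  exact Fintype.linearIndependent_iff.mp T.linearIndependent c hX b

theorem casimir_aux_expand (n : ℕ) (ι : Type*) [Fintype ι] [DecidableEq ι]
    (T : Module.Basis ι ℂ (Matrix (Fin n) (Fin n) ℂ))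
    (κ : Matrix ι ι ℂ) (hκ : ∀ a b : ι, κ a b = Matrix.trace (T a * T b))
    (X : Matrix (Fin n) (Fin n) ℂ) :
    ∑ a, (∑ b, κ⁻¹ a b * Matrix.trace (T b * X)) • T a = X := by
  have hd := casimir_aux_det n ι T κ hκ
  have h1 : (fun b => Matrix.trace (T b * X)) = κ *ᵥ (fun a => T.repr X a) := by
    funext b
    conv_lhs => rw [← T.sum_repr X]
    rw [Finset.mul_sum, Matrix.trace_sum]
    simp only [Matrix.mul_smul, Matrix.trace_smul, Matrix.mulVec, dotProduct, hκ, smul_eq_mul, mul_comm]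
  have h2 : κ⁻¹ *ᵥ (fun b => Matrix.trace (T b * X)) = fun a => T.repr X a := by
    rw [h1, Matrix.mulVec_mulVec, Matrix.nonsing_inv_mul _ hd, Matrix.one_mulVec]
  conv_rhs => rw [← T.sum_repr X]
  refine Finset.sum_congr rfl fun a _ => ?_
  rw [← congrFun h2 a]
  rfl

/-- Let `{T_a}` be a basis of `M_n(ℂ)` with Gram matrix
`κ_{ab} = tr(T_a · T_b)` and let `κ⁻¹` be its inverse. Then the element
`∑_{a,b} κ^{ab} T_a ⊗ T_b`, acting on `ℂ^n ⊗ ℂ^n` in the standard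
representation, acts as the swap operator. -/
theorem casimir_acts_as_swap (n : ℕ) (ι : Type*) [Fintype ι] [DecidableEq ι]
    (T : Module.Basis ι ℂ (Matrix (Fin n) (Fin n) ℂ))
    (κ : Matrix ι ι ℂ) (hκ : ∀ a b : ι, κ a b = Matrix.trace (T a * T b))
    (v w : Fin n → ℂ) :
    ∑ a : ι, ∑ b : ι,
        κ⁻¹ a b •
          TensorProduct.map (Matrix.mulVecLin (T a)) (Matrix.mulVecLin (T b)) (v ⊗ₜ[ℂ] w)
      = w ⊗ₜ[ℂ] v := by
  apply ((Pi.basisFun ℂ (Fin n)).tensorProduct (Pi.basisFun ℂ (Fin n))).ext_elem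
  rintro ⟨i, k⟩
  have h := casimir_aux_expand n ι T κ hκ (Matrix.vecMulVec w (Pi.single k 1))
  have h2 := congrFun (congrArg (fun M => M *ᵥ v) h) i
  have ht : ∀ b, Matrix.trace (T b * Matrix.vecMulVec w (Pi.single k 1)) = (T b *ᵥ w) k := by
    intro b
    rw [Matrix.mul_vecMulVec, Matrix.trace_vecMulVec]
    simp
  simp only [ht, Matrix.sum_mulVec, Matrix.smul_mulVec, Finset.sum_apply, Pi.smul_apply,
    smul_eq_mul, Matrix.vecMulVec_mulVec, Finset.sum_mul] at h2
  simp only [map_sum, map_smul, TensorProduct.map_tmul, Finsupp.coe_finsetSum, Finset.sum_apply,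
    Finsupp.smul_apply, Module.Basis.tensorProduct_repr_tmul_apply, Pi.basisFun_repr, smul_eq_mul,
    Matrix.mulVecLin_apply]
  simp at h2
  simp only [mul_comm, mul_left_comm, mul_assoc] at h2 ⊢
  exact h2
end

section
/- Let {T_a}_{a ∈ ι} be a basis of M_n(ℂ) with Gram matrix κ_{ab} = tr(T_a · T_b) with respect to the trace form, and let κ^{ab} denote the entries of the inverse matrix of κ. Then for all matrices A₁, A₂, B₁, B₂ ∈ M_n(ℂ): ∑_{a,b} tr(A₁ · T_a · A₂) · κ^{ab} · tr(B₁ · T_b · B₂) = tr(A₁ · B₂ · B₁ · A₂). -/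
open Matrix

/-- Let `{T_a}` be a basis of `M_n(ℂ)` with Gram matrix
`κ_{ab} = tr(T_a · T_b)` and let `κ⁻¹` be its inverse. Then
`∑_{a,b} tr(A₁ T_a A₂) κ^{ab} tr(B₁ T_b B₂) = tr(A₁ B₂ B₁ A₂)`. -/
theorem trace_fusion_general_basis (n : ℕ) (ι : Type*) [Fintype ι] [DecidableEq ι]
    (T : Module.Basis ι ℂ (Matrix (Fin n) (Fin n) ℂ))
    (κ : Matrix ι ι ℂ) (hκ : ∀ a b : ι, κ a b = Matrix.trace (T a * T b))
    (A₁ A₂ B₁ B₂ : Matrix (Fin n) (Fin n) ℂ) :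
    ∑ a : ι, ∑ b : ι,
        Matrix.trace (A₁ * T a * A₂) * κ⁻¹ a b * Matrix.trace (B₁ * T b * B₂)
      = Matrix.trace (A₁ * B₂ * B₁ * A₂) := by
  have key : ∀ (v : ι → ℂ) (a : ι), (κ *ᵥ v) a = Matrix.trace (T a * ∑ b, v b • T b) := by
    intro v a
    simp only [Matrix.mulVec, dotProduct, hκ, Finset.mul_sum, Matrix.trace_sum,
      Matrix.mul_smul, Matrix.trace_smul, smul_eq_mul]
    exact Finset.sum_congr rfl fun _ _ => mul_comm _ _
  have key2 : ∀ (v : ι → ℂ) (X : Matrix (Fin n) (Fin n) ℂ),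
      Matrix.trace ((∑ b, v b • T b) * X) = v ⬝ᵥ fun a => Matrix.trace (T a * X) := by
    intro v X
    simp only [dotProduct, Finset.sum_mul, Matrix.trace_sum,
      Matrix.smul_mul, Matrix.trace_smul, smul_eq_mul]
  have hu : IsUnit κ := by
    rw [← Matrix.mulVec_injective_iff_isUnit]
    refine (injective_iff_map_eq_zero (Matrix.mulVecLin κ)).2 ?_
    intro v hv
    have h0 : ∀ a, Matrix.trace (T a * ∑ b, v b • T b) = 0 := by
      intro a
      rw [← key]
      exact congrFun hv a
    have hz : ∑ b, v b • T b = 0 := by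
      rw [Matrix.ext_iff_trace_mul_left]
      intro X
      rw [← T.sum_repr X, key2]
      simp [h0, dotProduct]
    funext b
    exact Fintype.linearIndependent_iff.1 T.linearIndependent v hz b
  have hdet := (Matrix.isUnit_iff_isUnit_det κ).1 hu
  have hx : ∀ a, Matrix.trace (A₁ * T a * A₂) = (κ *ᵥ (T.repr (A₂ * A₁))) a := by
    intro a
    rw [key, T.sum_repr, Matrix.mul_assoc, Matrix.trace_mul_comm, Matrix.mul_assoc]
  have hy : ∀ a, Matrix.trace (B₁ * T a * B₂) = (κ *ᵥ (T.repr (B₂ * B₁))) a := by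
    intro a
    rw [key, T.sum_repr, Matrix.mul_assoc, Matrix.trace_mul_comm, Matrix.mul_assoc]
  have hs : ∑ a : ι, ∑ b : ι,
        Matrix.trace (A₁ * T a * A₂) * κ⁻¹ a b * Matrix.trace (B₁ * T b * B₂)
      = (κ *ᵥ (T.repr (A₂ * A₁))) ⬝ᵥ (κ⁻¹ *ᵥ (κ *ᵥ (T.repr (B₂ * B₁)))) := by
    simp only [hx, hy]
    generalize κ *ᵥ (T.repr (A₂ * A₁)) = p
    generalize κ *ᵥ (T.repr (B₂ * B₁)) = q
    simp only [dotProduct, Matrix.mulVec, Finset.mul_sum, mul_assoc]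
  rw [hs, Matrix.mulVec_mulVec, Matrix.nonsing_inv_mul _ hdet, Matrix.one_mulVec, dotProduct_comm]
  have : κ *ᵥ (T.repr (A₂ * A₁)) = fun a => Matrix.trace (T a * (A₂ * A₁)) := by
    funext a
    rw [key, T.sum_repr]
  rw [this, ← key2, T.sum_repr, Matrix.trace_mul_comm, ← Matrix.trace_mul_comm A₂]
  simp only [Matrix.mul_assoc]
end
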